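/- arXiv:2603.16571 — 3 statements merged into one kernel-verified Lean document; each statement's English description precedes it below -/
import Mathlib

section
/- Two-sided bound for the gravity mode: for N > 0, c_s > 0 and all real k, l, the gravity root satisfies g(k,l) ≤ x₋ ≤ 2·g(k,l), where g(k,l) = k²·N²·c_s² / (N² + (k² + l²)·c_s²) = k²·N² / (N²/c_s² + k² + l²) is the approximate gravity-wave dispersion relation. This justifies the approximation ω₋² ≈ k²N²/(N²/c_s² + k² + l²) up to a factor of 2. -/
/-- **Two-sided bound for the gravity mode.** For `N > 0`, `cs > 0` and all
real `k, l`, the gravity root satisfies `g(k,l) ≤ x₋ ≤ 2g(k,l)`, where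
`g(k,l) = k²N²cs²/(N² + (k² + l²)cs²)` is the approximate gravity-wave
dispersion relation, justifying `ω₋² ≈ k²N²/(N²/cs² + k² + l²)` up to a
factor of 2. -/
theorem gravity_mode_two_sided_bound (N cs : ℝ) (hN : 0 < N) (hcs : 0 < cs) (k l : ℝ) :
    (let b : ℝ := N ^ 2 + (k ^ 2 + l ^ 2) * cs ^ 2
     let c : ℝ := k ^ 2 * N ^ 2 * cs ^ 2
     let xm : ℝ := (b - Real.sqrt (b ^ 2 - 4 * c)) / 2
     let g : ℝ := k ^ 2 * N ^ 2 * cs ^ 2 / (N ^ 2 + (k ^ 2 + l ^ 2) * cs ^ 2)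
     g ≤ xm ∧ xm ≤ 2 * g) := by
  intro b c xm g
  have hb : 0 < b := by positivity
  have hc : 0 ≤ c := by positivity
  have hD : 0 ≤ b ^ 2 - 4 * c := by
    have h1 : 0 ≤ l ^ 2 * cs ^ 2 := by positivity
    have h2 : 0 ≤ N ^ 2 + k ^ 2 * cs ^ 2 := by positivity
    have h3 : b ^ 2 - 4 * c = (N ^ 2 - k ^ 2 * cs ^ 2) ^ 2
        + 2 * ((N ^ 2 + k ^ 2 * cs ^ 2) * (l ^ 2 * cs ^ 2)) + (l ^ 2 * cs ^ 2) ^ 2 := by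
      simp only [b, c]; ring
    rw [h3]; positivity
  have hs0 : 0 ≤ Real.sqrt (b ^ 2 - 4 * c) := Real.sqrt_nonneg _
  have hs2 : Real.sqrt (b ^ 2 - 4 * c) ^ 2 = b ^ 2 - 4 * c := Real.sq_sqrt hD
  have hsb : Real.sqrt (b ^ 2 - 4 * c) ≤ b :=
    (Real.sqrt_le_left hb.le).2 (by linarith)
  have hg : g = c / b := rfl
  have hx : xm = (b - Real.sqrt (b ^ 2 - 4 * c)) / 2 := rfl
  rw [hg, hx]
  clear_value b c
  generalize Real.sqrt (b ^ 2 - 4 * c) = s at *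
  constructor
  · rw [div_le_iff₀ hb]
    nlinarith [sq_nonneg (b - s)]
  · rw [← mul_div_assoc, le_div_iff₀ hb]
    nlinarith [mul_nonneg hs0 (sub_nonneg.2 hsb)]
end

section
/- Invertibility of the vertical-velocity/buoyancy mass matrix for the (1,0) discretisation: for all real k, l and all Δx, Δz > 0, the 2×2 complex matrix M_w = (ΔxΔz/36)·[[4(cos(lΔz) + 2), 2(cos(lΔz) + 2)·e^{ikΔx}], [2(cos(lΔz) + 2), 4(cos(lΔz) + 2)·e^{ikΔx}]] has determinant det M_w = 12·(ΔxΔz/36)²·(cos(lΔz) + 2)²·e^{ikΔx}, which is nonzero since cos(lΔz) + 2 ≥ 1; hence M_w is invertible. -/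
open Complex Matrix

/-- **Invertibility of the vertical-velocity/buoyancy mass matrix for the (1,0)
discretisation.** For all real `k, l` and all `Δx, Δz > 0`, the
Fourier-transformed matrix `M_w` has determinant
`12·(ΔxΔz/36)²·(cos(lΔz) + 2)²·e^{ikΔx}`, which is nonzero since
`cos(lΔz) + 2 ≥ 1`; hence `M_w` is invertible. -/
theorem mass_matrix_Mw_invertible_1_0 (k l Δx Δz : ℝ) (hΔx : 0 < Δx) (hΔz : 0 < Δz) :
    (let Mw : Matrix (Fin 2) (Fin 2) ℂ :=
      ((Δx * Δz / 36 : ℝ) : ℂ) •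
        !![4 * ((Real.cos (l * Δz) : ℂ) + 2),
             2 * ((Real.cos (l * Δz) : ℂ) + 2) * Complex.exp (Complex.I * (k * Δx));
           2 * ((Real.cos (l * Δz) : ℂ) + 2),
             4 * ((Real.cos (l * Δz) : ℂ) + 2) * Complex.exp (Complex.I * (k * Δx))]
     Mw.det = 12 * ((Δx * Δz / 36 : ℝ) : ℂ) ^ 2 * ((Real.cos (l * Δz) : ℂ) + 2) ^ 2 *
         Complex.exp (Complex.I * (k * Δx)) ∧
     (1 : ℝ) ≤ Real.cos (l * Δz) + 2 ∧
     Mw.det ≠ 0 ∧ IsUnit Mw) := by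
  intro Mw
  have hdet : Mw.det = 12 * ((Δx * Δz / 36 : ℝ) : ℂ) ^ 2 *
      ((Real.cos (l * Δz) : ℂ) + 2) ^ 2 * Complex.exp (Complex.I * (k * Δx)) := by
    simp only [Mw, Matrix.det_smul, Matrix.det_fin_two_of, Fintype.card_fin]
    ring
  have hc : (1 : ℝ) ≤ Real.cos (l * Δz) + 2 := by
    linarith [Real.neg_one_le_cos (l * Δz)]
  have hs : ((Δx * Δz / 36 : ℝ) : ℂ) ≠ 0 :=
    Complex.ofReal_ne_zero.mpr (by positivity)
  have hc' : ((Real.cos (l * Δz) : ℂ) + 2) ≠ 0 := by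
    have h : ((Real.cos (l * Δz) + 2 : ℝ) : ℂ) ≠ 0 :=
      Complex.ofReal_ne_zero.mpr (by linarith)
    rwa [Complex.ofReal_add, Complex.ofReal_ofNat] at h
  have hne : Mw.det ≠ 0 := by
    rw [hdet]
    exact mul_ne_zero (mul_ne_zero (mul_ne_zero (by norm_num) (pow_ne_zero 2 hs))
      (pow_ne_zero 2 hc')) (Complex.exp_ne_zero _)
  exact ⟨hdet, hc, hne, (Matrix.isUnit_iff_isUnit_det Mw).mpr (isUnit_iff_ne_zero.mpr hne)⟩
end

section
/- Invertibility of the global discrete mass matrix for the (1,0) discretisation: for all real k, l and all Δx, Δz > 0, the 8×8 complex block-diagonal matrix 𝓜 = diag(M_u, M_w, M_p, M_b), where M_u = (ΔxΔz/30)·[[(8 − 2cos(kΔx))·e^{ilΔz/2}, 4cos(kΔx/2)·e^{ilΔz/2}], [(2e^{ikΔx} + 2)·e^{ilΔz/2}, 16·e^{ikΔx/2}·e^{ilΔz/2}]], M_w = M_b = (ΔxΔz/36)·[[4(cos(lΔz) + 2), 2(cos(lΔz) + 2)·e^{ikΔx}], [2(cos(lΔz) + 2), 4(cos(lΔz) +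 2)·e^{ikΔx}]], and M_p = (ΔxΔz/6)·[[2e^{ilΔz/2}, e^{ilΔz/2}·e^{ikΔx}], [e^{ilΔz/2}, 2e^{ilΔz/2}·e^{ikΔx}]], is invertible. Consequently the discrete dispersion problem −iω𝓜x̂ + 𝓢x̂ = 0 can be recast as the eigenvalue problem ωx̂ = −i𝓜⁻¹𝓢x̂. -/
open Complex Matrix

lemma recast_aux {n : Type*} [Fintype n] [DecidableEq n] (M S : Matrix n n ℂ) (hM : IsUnit M)
    (x : n → ℂ) (ω : ℂ) :
    ((-(Complex.I * ω)) • (M *ᵥ x) + S *ᵥ x = 0 ↔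
      ω • x = (-Complex.I) • ((M⁻¹ * S) *ᵥ x)) := by
  have hd : IsUnit M.det := (Matrix.isUnit_iff_isUnit_det M).1 hM
  have h1 : M⁻¹ *ᵥ (M *ᵥ x) = x := by
    rw [Matrix.mulVec_mulVec, Matrix.nonsing_inv_mul M hd, Matrix.one_mulVec]
  have h2 : M *ᵥ ((M⁻¹ * S) *ᵥ x) = S *ᵥ x := by
    rw [Matrix.mulVec_mulVec, ← Matrix.mul_assoc, Matrix.mul_nonsing_inv M hd, Matrix.one_mul]
  constructor
  · intro h
    have h3 : S *ᵥ x = (Complex.I * ω) • (M *ᵥ x) := by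
      rw [neg_smul, neg_add_eq_zero] at h
      exact h.symm
    rw [← Matrix.mulVec_mulVec, h3, Matrix.mulVec_smul, h1, smul_smul, ← mul_assoc, neg_mul,
      Complex.I_mul_I, neg_neg, one_mul]
  · intro h
    have h3 : ω • (M *ᵥ x) = (-Complex.I) • (S *ᵥ x) := by
      rw [← Matrix.mulVec_smul, h, Matrix.mulVec_smul, h2]
    rw [neg_smul, mul_smul, h3, smul_smul, mul_neg, Complex.I_mul_I, neg_neg, one_smul,
      neg_add_cancel]

lemma det_smul_ne_zero_aux (c : ℂ) (hc : c ≠ 0) (A : Matrix (Fin 2) (Fin 2) ℂ)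
    (hA : A.det ≠ 0) : (c • A).det ≠ 0 := by
  rw [Matrix.det_smul]
  exact mul_ne_zero (pow_ne_zero _ hc) hA

/-- **Invertibility of the global discrete mass matrix for the (1,0)
discretisation.** For all real `k, l` and all `Δx, Δz > 0`, the 8×8 complex
block-diagonal matrix `𝓜 = diag(M_u, M_w, M_p, M_b)` (with `M_b = M_w`) is
invertible; consequently the discrete dispersion problem
`−iω𝓜xhat + 𝓢xhat = 0` can be recast as the eigenvalue problem
`ωxhat = −i𝓜⁻¹𝓢xhat`. -/
theorem global_mass_matrix_invertible_1_0 (k l Δx Δz : ℝ) (hΔx : 0 < Δx) (hΔz : 0 < Δz) :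
    (let Mu : Matrix (Fin 2) (Fin 2) ℂ :=
      ((Δx * Δz / 30 : ℝ) : ℂ) •
        !![((8 : ℂ) - 2 * Real.cos (k * Δx)) * Complex.exp (Complex.I * (l * Δz / 2)),
             4 * Real.cos (k * Δx / 2) * Complex.exp (Complex.I * (l * Δz / 2));
           (2 * Complex.exp (Complex.I * (k * Δx)) + 2) * Complex.exp (Complex.I * (l * Δz / 2)),
             16 * Complex.exp (Complex.I * (k * Δx / 2)) * Complex.exp (Complex.I * (l * Δz / 2))]
     let Mw : Matrix (Fin 2) (Fin 2) ℂ :=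
      ((Δx * Δz / 36 : ℝ) : ℂ) •
        !![4 * ((Real.cos (l * Δz) : ℂ) + 2),
             2 * ((Real.cos (l * Δz) : ℂ) + 2) * Complex.exp (Complex.I * (k * Δx));
           2 * ((Real.cos (l * Δz) : ℂ) + 2),
             4 * ((Real.cos (l * Δz) : ℂ) + 2) * Complex.exp (Complex.I * (k * Δx))]
     let Mp : Matrix (Fin 2) (Fin 2) ℂ :=
      ((Δx * Δz / 6 : ℝ) : ℂ) •
        !![2 * Complex.exp (Complex.I * (l * Δz / 2)),
             Complex.exp (Complex.I * (l * Δz / 2)) * Complex.exp (Complex.I * (k * Δx));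
           Complex.exp (Complex.I * (l * Δz / 2)),
             2 * Complex.exp (Complex.I * (l * Δz / 2)) * Complex.exp (Complex.I * (k * Δx))]
     let Mb : Matrix (Fin 2) (Fin 2) ℂ := Mw
     let 𝓜 : Matrix ((Fin 2 ⊕ Fin 2) ⊕ (Fin 2 ⊕ Fin 2)) ((Fin 2 ⊕ Fin 2) ⊕ (Fin 2 ⊕ Fin 2)) ℂ :=
       Matrix.fromBlocks (Matrix.fromBlocks Mu 0 0 Mw) 0 0 (Matrix.fromBlocks Mp 0 0 Mb)
     IsUnit 𝓜 ∧
     ∀ (𝓢 : Matrix ((Fin 2 ⊕ Fin 2) ⊕ (Fin 2 ⊕ Fin 2)) ((Fin 2 ⊕ Fin 2) ⊕ (Fin 2 ⊕ Fin 2)) ℂ)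
       (xhat : ((Fin 2 ⊕ Fin 2) ⊕ (Fin 2 ⊕ Fin 2)) → ℂ) (ω : ℂ),
       ((-(Complex.I * ω)) • (𝓜 *ᵥ xhat) + 𝓢 *ᵥ xhat = 0 ↔
         ω • xhat = (-Complex.I) • ((𝓜⁻¹ * 𝓢) *ᵥ xhat))) := by
  intro Mu Mw Mp Mb 𝓜
  have hp : 0 < Δx * Δz := mul_pos hΔx hΔz
  have hexp : ∀ z : ℂ, Complex.exp z ≠ 0 := Complex.exp_ne_zero
  have hu : Mu.det ≠ 0 := by
    refine det_smul_ne_zero_aux _ (Complex.ofReal_ne_zero.2 (by positivity)) _ ?_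
    have hc : Real.cos (k * Δx) = 2 * Real.cos (k * Δx / 2) ^ 2 - 1 := by
      rw [← Real.cos_two_mul]; congr 1; ring
    have he : Complex.exp (Complex.I * (k * Δx)) = Complex.exp (Complex.I * (k * Δx / 2)) ^ 2 := by
      rw [← Complex.exp_nat_mul]; congr 1; push_cast; ring
    have hh : Complex.exp (Complex.I * (k * Δx / 2)) ^ 2 + 1
        = 2 * (Real.cos (k * Δx / 2) : ℂ) * Complex.exp (Complex.I * (k * Δx / 2)) := by
      have : (2 * (Real.cos (k * Δx / 2) : ℂ)) = Complex.exp (Complex.I * (k * Δx / 2))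
          + Complex.exp (-(Complex.I * (k * Δx / 2))) := by
        push_cast
        rw [Complex.two_cos]
        congr 2 <;> ring
      rw [this, add_mul, ← Complex.exp_add (-_), neg_add_cancel, Complex.exp_zero, sq]
    rw [Matrix.det_fin_two_of, he, hc]
    set h := Complex.exp (Complex.I * (k * Δx / 2)) with hh0
    set E := Complex.exp (Complex.I * (l * Δz / 2)) with hE
    have hcc := Real.cos_sq_le_one (k * Δx / 2)
    set c := Real.cos (k * Δx / 2) with hcdef
    have hne : ((160 - 80 * c ^ 2 : ℝ) : ℂ) ≠ 0 := Complex.ofReal_ne_zero.2 (by nlinarith)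
    have key : E ^ 2 * h * ((160 - 80 * c ^ 2 : ℝ) : ℂ) ≠ 0 :=
      mul_ne_zero (mul_ne_zero (pow_ne_zero _ (hexp _)) (hexp _)) hne
    intro h0
    apply key
    rw [← h0]
    push_cast
    linear_combination (8 * (c : ℂ) * E ^ 2) * hh
  have hw : Mw.det ≠ 0 := by
    refine det_smul_ne_zero_aux _ (Complex.ofReal_ne_zero.2 (by positivity)) _ ?_
    rw [Matrix.det_fin_two_of]
    have hne : ((Real.cos (l * Δz) : ℂ) + 2) ≠ 0 := by
      have h1 : Real.cos (l * Δz) + 2 ≠ 0 := by linarith [Real.neg_one_le_cos (l * Δz)]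
      exact_mod_cast h1
    have key := mul_ne_zero (mul_ne_zero (by norm_num : (12 : ℂ) ≠ 0) (pow_ne_zero 2 hne))
      (hexp (Complex.I * (k * Δx)))
    intro h0
    apply key
    rw [← h0]
    ring
  have hpp : Mp.det ≠ 0 := by
    refine det_smul_ne_zero_aux _ (Complex.ofReal_ne_zero.2 (by positivity)) _ ?_
    rw [Matrix.det_fin_two_of]
    have key := mul_ne_zero (mul_ne_zero (by norm_num : (3 : ℂ) ≠ 0)
      (pow_ne_zero 2 (hexp (Complex.I * (l * Δz / 2))))) (hexp (Complex.I * (k * Δx)))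
    intro h0
    apply key
    rw [← h0]
    ring
  have hM : IsUnit 𝓜 := by
    rw [Matrix.isUnit_iff_isUnit_det, isUnit_iff_ne_zero]
    change (Matrix.fromBlocks (Matrix.fromBlocks Mu 0 0 Mw) 0 0
      (Matrix.fromBlocks Mp 0 0 Mw)).det ≠ 0
    rw [Matrix.det_fromBlocks_zero₂₁, Matrix.det_fromBlocks_zero₂₁, Matrix.det_fromBlocks_zero₂₁]
    exact mul_ne_zero (mul_ne_zero hu hw) (mul_ne_zero hpp hw)
  exact ⟨hM, fun S x ω => recast_aux 𝓜 S hM x ω⟩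
end
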